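/- For 0 ≤ δ < 1/2, one has b̂_δ(1) − b̂_δ(0) = (2 cos(πδ)/π) · (2/(1 − 4δ²)), and consequently b̂_δ(1) − b̂_δ(0) ≥ 4/π − 2πδ². -/

import Mathlib

/-- The 1-periodic function `b_δ`, equal to `i e^{iπθ}` for `δ ≤ θ ≤ 1 - δ` and to
`-e^{(1-(2δ)⁻¹) iπθ}` for `-δ < θ ≤ δ` (extended 1-periodically). -/
noncomputable def bFun (δ θ : ℝ) : ℂ :=
  let u : ℝ := Int.fract (θ + δ) - δ
  if δ ≤ u then Complex.I * Complex.exp (Complex.I * (Real.pi : ℂ) * (u : ℂ))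
  else -Complex.exp (((1 - (2 * δ)⁻¹ : ℝ) : ℂ) * Complex.I * (Real.pi : ℂ) * (u : ℂ))

/-- The `j`-th Fourier coefficient of `b_δ`, given by the explicit formula
`sin(2π(jδ - δ/2 + 1/4)) / ((2j-1)·2π·(jδ - δ/2 + 1/4))`. -/
noncomputable def bHat (δ : ℝ) (j : ℤ) : ℝ :=
  Real.sin (2 * Real.pi * ((j : ℝ) * δ - δ / 2 + 1 / 4)) /
    (((2 * (j : ℝ) - 1)) * (2 * Real.pi) * ((j : ℝ) * δ - δ / 2 + 1 / 4))

theorem bHat_one_sub_bHat_zero (δ : ℝ) (h0 : 0 ≤ δ) (h1 : δ < 1 / 2) :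
    bHat δ 1 - bHat δ 0 =
      (2 * Real.cos (Real.pi * δ) / Real.pi) * (2 / (1 - 4 * δ ^ 2)) := by
  have hs1 : Real.sin (2 * Real.pi * (1 * δ - δ / 2 + 1 / 4)) = Real.cos (Real.pi * δ) := by
    rw [← Real.sin_add_pi_div_two]
    ring_nf
  have hs0 : Real.sin (2 * Real.pi * (0 * δ - δ / 2 + 1 / 4)) = Real.cos (Real.pi * δ) := by
    rw [← Real.sin_pi_div_two_sub]
    ring_nf
  have hd1 : (2 * 1 - 1) * (2 * Real.pi) * (1 * δ - δ / 2 + 1 / 4) =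
      Real.pi * (1 + 2 * δ) / 2 := by ring
  have hd0 : (2 * 0 - 1) * (2 * Real.pi) * (0 * δ - δ / 2 + 1 / 4) =
      -(Real.pi * (1 - 2 * δ) / 2) := by ring
  have hp : 0 < 1 + 2 * δ := by linarith
  have hm : 0 < 1 - 2 * δ := by linarith
  have hfac : 1 - 4 * δ ^ 2 = (1 + 2 * δ) * (1 - 2 * δ) := by ring
  simp only [bHat, Int.cast_one, Int.cast_zero]
  rw [hs1, hs0, hd1, hd0, hfac, div_neg, sub_neg_eq_add]
  have hsum : 1 + 2 * δ + (1 - 2 * δ) = 2 := by ring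
  generalize 1 + 2 * δ = p at hp hsum ⊢
  generalize 1 - 2 * δ = m at hm hsum ⊢
  field_simp
  linear_combination Real.cos (Real.pi * δ) * hsum

/-- For `0 ≤ δ < 1/2`,
`b̂_δ(1) - b̂_δ(0) = (2 cos(πδ)/π) · (2/(1 - 4δ²))`, and consequently
`b̂_δ(1) - b̂_δ(0) ≥ 4/π - 2πδ²`. -/
theorem bHat_diff_formula (δ : ℝ) (h0 : 0 ≤ δ) (h1 : δ < 1 / 2) :
    bHat δ 1 - bHat δ 0 = (2 * Real.cos (Real.pi * δ) / Real.pi) * (2 / (1 - 4 * δ ^ 2)) ∧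
    4 / Real.pi - 2 * Real.pi * δ ^ 2 ≤ bHat δ 1 - bHat δ 0 := by
  refine ⟨bHat_one_sub_bHat_zero δ h0 h1, ?_⟩
  rw [bHat_one_sub_bHat_zero δ h0 h1]
  have hπ := Real.pi_pos
  have hcos : 0 ≤ Real.cos (Real.pi * δ) :=
    Real.cos_nonneg_of_mem_Icc ⟨by nlinarith, by nlinarith⟩
  have hfrac : 2 ≤ 2 / (1 - 4 * δ ^ 2) := by
    rw [le_div_iff₀ (by nlinarith)]
    nlinarith
  calc 4 / Real.pi - 2 * Real.pi * δ ^ 2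
      = 2 * (1 - (Real.pi * δ) ^ 2 / 2) / Real.pi * 2 := by field_simp; ring
    _ ≤ 2 * Real.cos (Real.pi * δ) / Real.pi * 2 := by
        gcongr
        exact Real.one_sub_sq_div_two_le_cos
    _ ≤ 2 * Real.cos (Real.pi * δ) / Real.pi * (2 / (1 - 4 * δ ^ 2)) := by gcongr
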